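/- Let q be a prime power and n, k, m, r positive integers with k | m, m | r, and r | n. Let γ ∈ F_{q^m}^* be a root of an irreducible polynomial of degree m/k over F_{q^k}, where m/k > 2; let ξ ∈ F_{q^r}^* be a root of an irreducible polynomial of degree r/m over F_{q^m}, where r/m > 4; and let ζ ∈ F_{q^n}^* be a root of an irreducible polynomial of degree n/r over F_{q^r}, where n/r > 4. Let δ_1, δ_2, τ_1, τ_2, η_1, η_2 ∈ F_{q^k}^*. Then U = {δ_1 a + δ_2 a^q γ + τ_1 u ξ + τ_2 u^q ξ^2 + η_1 e ζ + η_2 e^q ζ^2 : a, u, e ∈ F_{q^k}} is a Sidon space of F_q-dimension 3k. -/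

import Mathlib

open Submodule Pointwise

set_option maxHeartbeats 1000000
set_option synthInstance.maxHeartbeats 400000

/-- An `F`-subspace `V` of a field `K` is a *Sidon space* if for all nonzero
`a, b, c, d ∈ V` with `a * b = c * d` one has `{aF, bF} = {cF, dF}` (as a pair of
one-dimensional `F`-subspaces). -/
def IsSidonSpace {K : Type*} [Field K] (F : Subfield K) (V : Submodule F K) : Prop :=
  ∀ a ∈ V, ∀ b ∈ V, ∀ c ∈ V, ∀ d ∈ V,
    a ≠ 0 → b ≠ 0 → c ≠ 0 → d ≠ 0 → a * b = c * d →
    ({Submodule.span F {a}, Submodule.span F {b}} : Set (Submodule F K)) =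
      {Submodule.span F {c}, Submodule.span F {d}}

section ProductIdentities

variable {K : Type*} [Field K]

/-- The products `f 0 * f 1` and `f 2 * f 3` agree. -/
def ProdEq (f : Fin 4 → K) : Prop := f 0 * f 1 = f 2 * f 3

/-- The symmetrised products of `f` and `g` on the index pairs `(0, 1)` and `(2, 3)` agree. -/
def SymmEq (f g : Fin 4 → K) : Prop := f 0 * g 1 + f 1 * g 0 = f 2 * g 3 + f 3 * g 2

lemma ProdEq.symmEq {f : Fin 4 → K} (h : ProdEq f) : SymmEq f f := by
  unfold ProdEq SymmEq at *
  linear_combination 2 * h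

lemma SymmEq.symm {f g : Fin 4 → K} (h : SymmEq f g) : SymmEq g f := by
  unfold SymmEq at *
  linear_combination h

lemma SymmEq.of_mul_mul {f g : Fin 4 → K} {s t : K} (hs : s ≠ 0) (ht : t ≠ 0)
    (h : SymmEq (fun i ↦ s * f i) (fun i ↦ t * g i)) : SymmEq f g := by
  unfold SymmEq at *
  apply mul_left_cancel₀ (mul_ne_zero hs ht)
  linear_combination h

lemma SymmEq.of_mul_left {f g : Fin 4 → K} {s : K} (hs : s ≠ 0)
    (h : SymmEq (fun i ↦ s * f i) g) : SymmEq f g :=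
  SymmEq.of_mul_mul hs one_ne_zero (by simpa using h)

lemma SymmEq.of_mul_right {f g : Fin 4 → K} {t : K} (ht : t ≠ 0)
    (h : SymmEq f (fun i ↦ t * g i)) : SymmEq f g :=
  SymmEq.of_mul_mul one_ne_zero ht (by simpa using h)

lemma ProdEq.of_mul {f : Fin 4 → K} {s : K} (hs : s ≠ 0)
    (h : ProdEq (fun i ↦ s * f i)) : ProdEq f := by
  unfold ProdEq at *
  apply mul_left_cancel₀ (mul_ne_zero hs hs)
  linear_combination h

lemma ProdEq.of_pow {f : Fin 4 → K} {q : ℕ} (hinj : Function.Injective fun x : K ↦ x ^ q)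
    (h : ProdEq (fun i ↦ f i ^ q)) : ProdEq f := by
  apply hinj
  simpa only [ProdEq, mul_pow] using h

lemma coeff_eq_zero_of_sum_pow_eq_zero (L : Subfield K) {x : K} {d : ℕ}
    (hd : d ≤ (minpoly L x).natDegree) {c : Fin d → K} (hc : ∀ i, c i ∈ L)
    (h : ∑ i, c i * x ^ (i : ℕ) = 0) (i : Fin d) : c i = 0 := by
  have hli := (linearIndependent_pow (K := L) x).comp (Fin.castLE hd) (Fin.castLE_injective hd)
  have := Fintype.linearIndependent_iff.1 hli (fun i ↦ ⟨c i, hc i⟩)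
    (by simpa [Subfield.smul_def] using h) i
  simpa using congrArg Subtype.val this

lemma quadratic_coeffs_eq_zero (L : Subfield K) {x : K} (hd : 2 < (minpoly L x).natDegree)
    {a b c : K} (ha : a ∈ L) (hb : b ∈ L) (hc : c ∈ L) (h : a + b * x + c * x ^ 2 = 0) :
    a = 0 ∧ b = 0 ∧ c = 0 := by
  have key := coeff_eq_zero_of_sum_pow_eq_zero L (d := 3) hd (c := ![a, b, c])
    (by intro i; fin_cases i <;> simpa) (by simpa [Fin.sum_univ_succ, ← add_assoc] using h)
  exact ⟨key 0, key 1, key 2⟩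

lemma quartic_coeffs_eq_zero (L : Subfield K) {x : K} (hd : 4 < (minpoly L x).natDegree)
    {a b c d e : K} (ha : a ∈ L) (hb : b ∈ L) (hc : c ∈ L) (hd' : d ∈ L) (he : e ∈ L)
    (h : a + b * x + c * x ^ 2 + d * x ^ 3 + e * x ^ 4 = 0) :
    a = 0 ∧ b = 0 ∧ c = 0 ∧ d = 0 ∧ e = 0 := by
  have key := coeff_eq_zero_of_sum_pow_eq_zero L (d := 5) hd (c := ![a, b, c, d, e])
    (by intro i; fin_cases i <;> simpa) (by simpa [Fin.sum_univ_succ, ← add_assoc] using h)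
  exact ⟨key 0, key 1, key 2, key 3, key 4⟩

lemma ProdEq.linear_coeffs (L : Subfield K) {x : K} (hd : 2 < (minpoly L x).natDegree)
    {A B : Fin 4 → K} (hA : ∀ i, A i ∈ L) (hB : ∀ i, B i ∈ L)
    (h : ProdEq (fun i ↦ A i + B i * x)) : ProdEq A ∧ SymmEq A B ∧ ProdEq B := by
  unfold ProdEq SymmEq at *
  obtain ⟨h0, h1, h2⟩ := quadratic_coeffs_eq_zero L hd
    (a := A 0 * A 1 - A 2 * A 3)
    (b := A 0 * B 1 + A 1 * B 0 - (A 2 * B 3 + A 3 * B 2))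
    (c := B 0 * B 1 - B 2 * B 3)
    (sub_mem (mul_mem (hA _) (hA _)) (mul_mem (hA _) (hA _)))
    (sub_mem (add_mem (mul_mem (hA _) (hB _)) (mul_mem (hA _) (hB _)))
      (add_mem (mul_mem (hA _) (hB _)) (mul_mem (hA _) (hB _))))
    (sub_mem (mul_mem (hB _) (hB _)) (mul_mem (hB _) (hB _))) (by linear_combination h)
  exact ⟨sub_eq_zero.1 h0, sub_eq_zero.1 h1, sub_eq_zero.1 h2⟩

lemma SymmEq.quadratic_coeffs (L : Subfield K) {x : K} (hd : 2 < (minpoly L x).natDegree)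
    {A B C w : Fin 4 → K} (hA : ∀ i, A i ∈ L) (hB : ∀ i, B i ∈ L) (hC : ∀ i, C i ∈ L)
    (hw : ∀ i, w i ∈ L) (h : SymmEq (fun i ↦ A i + B i * x + C i * x ^ 2) w) :
    SymmEq A w ∧ SymmEq B w ∧ SymmEq C w := by
  have mem {f : Fin 4 → K} (hf : ∀ i, f i ∈ L) :
      f 0 * w 1 + f 1 * w 0 - (f 2 * w 3 + f 3 * w 2) ∈ L :=
    sub_mem (add_mem (mul_mem (hf _) (hw _)) (mul_mem (hf _) (hw _)))
      (add_mem (mul_mem (hf _) (hw _)) (mul_mem (hf _) (hw _)))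
  unfold SymmEq at *
  obtain ⟨h0, h1, h2⟩ := quadratic_coeffs_eq_zero L hd (mem hA) (mem hB) (mem hC)
    (by linear_combination h)
  exact ⟨sub_eq_zero.1 h0, sub_eq_zero.1 h1, sub_eq_zero.1 h2⟩

lemma ProdEq.frobenius_coeffs (L : Subfield K) {x : K} (hd : 4 < (minpoly L x).natDegree)
    {q : ℕ} (hinj : Function.Injective fun x : K ↦ x ^ q) {A u : Fin 4 → K}
    (hA : ∀ i, A i ∈ L) (hu : ∀ i, u i ∈ L) {s t : K} (hs : s ∈ L) (ht : t ∈ L) (hs0 : s ≠ 0)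
    (ht0 : t ≠ 0) (h : ProdEq (fun i ↦ A i + s * u i * x + t * u i ^ q * x ^ 2)) :
    ProdEq A ∧ ProdEq u ∧ SymmEq A u ∧ SymmEq A (fun i ↦ u i ^ q) ∧
      SymmEq u (fun i ↦ u i ^ q) := by
  have hB (i) : s * u i ∈ L := mul_mem hs (hu i)
  have hC (i) : t * u i ^ q ∈ L := mul_mem ht (pow_mem (hu i) q)
  have memP {f : Fin 4 → K} (hf : ∀ i, f i ∈ L) : f 0 * f 1 - f 2 * f 3 ∈ L :=
    sub_mem (mul_mem (hf _) (hf _)) (mul_mem (hf _) (hf _))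
  have memS {f g : Fin 4 → K} (hf : ∀ i, f i ∈ L) (hg : ∀ i, g i ∈ L) :
      f 0 * g 1 + f 1 * g 0 - (f 2 * g 3 + f 3 * g 2) ∈ L :=
    sub_mem (add_mem (mul_mem (hf _) (hg _)) (mul_mem (hf _) (hg _)))
      (add_mem (mul_mem (hf _) (hg _)) (mul_mem (hf _) (hg _)))
  obtain ⟨h0, h1, h2, h3, h4⟩ := quartic_coeffs_eq_zero L hd (memP hA) (memS hA hB)
    (add_mem (memS hA hC) (memP hB)) (memS hB hC) (memP hC) (by
      unfold ProdEq at h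
      linear_combination h)
  have hu4 : ProdEq u := ProdEq.of_pow hinj (ProdEq.of_mul ht0 (sub_eq_zero.1 h4))
  refine ⟨sub_eq_zero.1 h0, hu4, SymmEq.of_mul_right hs0 (sub_eq_zero.1 h1),
    SymmEq.of_mul_right ht0 ?_, SymmEq.of_mul_mul hs0 ht0 (sub_eq_zero.1 h3)⟩
  unfold ProdEq at hu4
  unfold SymmEq
  linear_combination h2 - s ^ 2 * hu4

/-- Unique factorisation for a product of two linear forms. -/
lemma proportional_of_mul_eq_mul {ι : Type*} {v : Fin 4 → ι → K} (h₀ : v 0 ≠ 0) (h₂ : v 2 ≠ 0)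
    (h₃ : v 3 ≠ 0) (hP : ∀ i, ProdEq (v · i)) (hS : ∀ i j, SymmEq (v · i) (v · j)) :
    ∃ c : K, c ≠ 0 ∧ ((v 2 = c • v 0 ∧ v 1 = c • v 3) ∨ (v 3 = c • v 0 ∧ v 1 = c • v 2)) := by
  simp only [ProdEq, SymmEq] at hP hS
  obtain ⟨k, hk⟩ := Function.ne_iff.1 h₀
  simp only [Pi.zero_apply] at hk
  have aux {y z : ι → K} (hy0 : y ≠ 0) (hP : ∀ i, v 0 i * v 1 i = y i * z i)
      (hS : ∀ i j, v 0 i * v 1 j + v 1 i * v 0 j = y i * z j + z i * y j)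
      (hy : ∀ i, v 0 k * y i = y k * v 0 i) :
      ∃ c : K, c ≠ 0 ∧ y = c • v 0 ∧ v 1 = c • z := by
    have hyc : y = (y k / v 0 k) • v 0 := by
      ext i
      simp only [Pi.smul_apply, smul_eq_mul]
      field_simp
      linear_combination hy i
    have hk' : v 1 k = y k / v 0 k * z k := by
      field_simp
      linear_combination hP k
    refine ⟨y k / v 0 k, ?_, hyc, ?_⟩
    · intro h
      rw [h, zero_smul] at hyc
      exact hy0 hyc
    · ext i
      simp only [Pi.smul_apply, smul_eq_mul]
      have h1 := hS k i
      rw [hk'] at h1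
      have h2 := hy i
      field_simp at h1 ⊢
      apply mul_left_cancel₀ hk
      linear_combination h1 + z k * h2
  by_cases hx : ∀ i, v 0 k * v 2 i = v 2 k * v 0 i
  · obtain ⟨c, hc, h⟩ := aux h₂ hP
      (fun i j ↦ by linear_combination hS i j) hx
    exact ⟨c, hc, .inl h⟩
  · push Not at hx
    obtain ⟨j, hj⟩ := hx
    have hj' : v 0 k * v 3 j - v 3 k * v 0 j = 0 := by
      apply (mul_eq_zero.1 _).resolve_left (sub_ne_zero.2 hj)
      linear_combination v 0 k * v 0 j * hS k j - v 0 k ^ 2 * hP j - v 0 j ^ 2 * hP k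
    have hy (i) : v 0 k * v 3 i = v 3 k * v 0 i := by
      have : v 0 k * v 3 i - v 3 k * v 0 i = 0 := by
        apply (mul_eq_zero.1 _).resolve_left (sub_ne_zero.2 hj)
        linear_combination (-(v 0 k * v 2 i - v 2 k * v 0 i)) * hj'
          - v 0 k ^ 2 * hS i j + v 0 k * v 0 j * hS k i + v 0 k * v 0 i * hS k j
          - 2 * v 0 i * v 0 j * hP k
      exact sub_eq_zero.1 this
    obtain ⟨c, hc, h⟩ := aux (y := v 3) (z := v 2) h₃
      (fun i ↦ by linear_combination hP i) (fun i j ↦ by linear_combination hS i j) hy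
    exact ⟨c, hc, .inr h⟩

/-- Vectors whose symmetric product and Frobenius-twisted product agree are proportional by a
scalar fixed by the Frobenius. -/
lemma proportional_of_frobenius_mul_eq {ι : Type*} {q : ℕ} {v : Fin 4 → ι → K} (h₀ : v 0 ≠ 0)
    (h₂ : v 2 ≠ 0) (h₃ : v 3 ≠ 0) (hP : ∀ i, ProdEq (v · i))
    (hS : ∀ i j, SymmEq (v · i) (v · j)) (hF : ∀ i j, SymmEq (v · i) (v · j ^ q)) :
    ∃ c : K, c ≠ 0 ∧ c ^ q = c ∧
      ((v 2 = c • v 0 ∧ v 1 = c • v 3) ∨ (v 3 = c • v 0 ∧ v 1 = c • v 2)) := by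
  have aux {y z : ι → K} {c : K} (hc : c ≠ 0) (hz : z ≠ 0) (hy : y = c • v 0)
      (hv : v 1 = c • z)
      (hF : ∀ i j, v 0 i * v 1 j ^ q + v 1 i * v 0 j ^ q = y i * z j ^ q + z i * y j ^ q) :
      ∃ c : K, c ≠ 0 ∧ c ^ q = c ∧
        ((y = c • v 0 ∧ v 1 = c • z) ∨ (z = c • v 0 ∧ v 1 = c • y)) := by
    by_cases hcq : c ^ q = c
    · exact ⟨c, hc, hcq, .inl ⟨hy, hv⟩⟩
    have key (i j) : v 0 i * z j ^ q = z i * v 0 j ^ q := by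
      have h := hF i j
      simp only [hy, hv, Pi.smul_apply, smul_eq_mul, mul_pow] at h
      apply mul_left_cancel₀ (sub_ne_zero.2 hcq)
      linear_combination h
    obtain ⟨k, hk⟩ := Function.ne_iff.1 hz
    simp only [Pi.zero_apply] at hk
    have hkq : z k ^ q ≠ 0 := pow_ne_zero _ hk
    obtain ⟨d, hd⟩ : ∃ d, d = (v 0 k / z k) ^ q := ⟨_, rfl⟩
    have hv0 (i) : v 0 i = d * z i := by
      rw [hd, div_pow]
      field_simp
      linear_combination key i k
    have hd0 : d ≠ 0 := by
      rintro rfl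
      exact h₀ (funext fun i ↦ by simp [hv0 i])
    have hdq : d ^ q = d := by
      nth_rw 2 [hd]
      rw [hv0 k, mul_div_cancel_right₀ _ hk]
    refine ⟨d⁻¹, inv_ne_zero hd0, by rw [inv_pow, hdq], .inr ⟨?_, ?_⟩⟩
    · ext i
      simp [hv0 i, hd0]
    · ext i
      simp only [hv, hy, Pi.smul_apply, smul_eq_mul, hv0 i]
      field_simp
  obtain ⟨c, hc, ⟨h, h'⟩ | ⟨h, h'⟩⟩ := proportional_of_mul_eq_mul h₀ h₂ h₃ hP hS
  · exact aux hc h₃ h h' hF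
  · obtain ⟨d, hd, hdq, hor⟩ := aux hc h₂ h h'
      (fun i j ↦ by have := hF i j; unfold SymmEq at this; linear_combination this)
    exact ⟨d, hd, hdq, hor.symm⟩

end ProductIdentities

section FiniteFields

variable {K : Type*} [Field K]

lemma Subfield.mem_of_pow_natCard_eq_self (F : Subfield K) [Finite F] {x : K}
    (hx : x ^ Nat.card F = x) : x ∈ F := by
  classical
  have := Fintype.ofFinite F
  have hq : 1 < Nat.card F := Finite.one_lt_card
  have hne : (Polynomial.X ^ Nat.card F - Polynomial.X : Polynomial K) ≠ 0 :=
    FiniteField.X_pow_card_sub_X_ne_zero K hq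
  have hsub : (F : Set K).toFinset ⊆
      (Polynomial.X ^ Nat.card F - Polynomial.X : Polynomial K).roots.toFinset := by
    intro y hy
    have hyF : y ∈ F := by simpa using hy
    have hpow : y ^ Nat.card F = y := by
      have h := FiniteField.pow_card (⟨y, hyF⟩ : F)
      rw [← Nat.card_eq_fintype_card] at h
      exact congrArg Subtype.val h
    exact Multiset.mem_toFinset.2 ((Polynomial.mem_roots hne).2 (by
      simp [-Nat.card_eq_fintype_card, hpow]))
  have heq := Finset.eq_of_subset_of_card_le hsub (by
    refine (Multiset.toFinset_card_le _).trans ((Polynomial.card_roots' _).trans ?_)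
    rw [FiniteField.X_pow_card_sub_X_natDegree_eq K hq, Set.toFinset_card,
      ← Nat.card_eq_fintype_card]
    rfl)
  have : x ∈ (F : Set K).toFinset := by
    rw [heq]
    exact Multiset.mem_toFinset.2 ((Polynomial.mem_roots hne).2 (by
      simp [-Nat.card_eq_fintype_card, hx]))
  simpa using this

end FiniteFields

/-- For `k ∣ m ∣ r ∣ n`, with `γ ∈ F_{q^m}^*` of degree `m/k > 2` over
`F_{q^k}`, `ξ ∈ F_{q^r}^*` of degree `r/m > 4` over `F_{q^m}`, and `ζ ∈ F_{q^n}^*` of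
degree `n/r > 4` over `F_{q^r}`, the indicated set is a Sidon space of dimension `3k`. -/
theorem sidonSpace_three_generators_14 {K : Type*} [Field K] (q n k m r : ℕ)
    (hq : IsPrimePow q) (hn : 0 < n) (hk : 0 < k) (hm : 0 < m) (hr : 0 < r)
    (hkm : k ∣ m) (hmr : m ∣ r) (hrn : r ∣ n)
    (hK : Nat.card K = q ^ n)
    (F : Subfield K) (hF : Nat.card F = q)
    (Fk : Subfield K) (hFk : Nat.card Fk = q ^ k) (hFFk : F ≤ Fk)
    (Fm : Subfield K) (hFm : Nat.card Fm = q ^ m) (hFkFm : Fk ≤ Fm)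
    (Fr : Subfield K) (hFr : Nat.card Fr = q ^ r) (hFmFr : Fm ≤ Fr)
    (γ : K) (hγFm : γ ∈ Fm) (hγ : γ ≠ 0)
    (hdegγ : (minpoly Fk γ).natDegree = m / k) (hdegγ' : 2 < m / k)
    (ξ : K) (hξFr : ξ ∈ Fr) (hξ : ξ ≠ 0)
    (hdegξ : (minpoly Fm ξ).natDegree = r / m) (hdegξ' : 4 < r / m)
    (ζ : K) (hζ : ζ ≠ 0)
    (hdegζ : (minpoly Fr ζ).natDegree = n / r) (hdegζ' : 4 < n / r)
    (δ₁ δ₂ τ₁ τ₂ η₁ η₂ : K)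
    (hδ₁ : δ₁ ∈ Fk) (hδ₂ : δ₂ ∈ Fk) (hτ₁ : τ₁ ∈ Fk) (hτ₂ : τ₂ ∈ Fk)
    (hη₁ : η₁ ∈ Fk) (hη₂ : η₂ ∈ Fk)
    (hδ₁0 : δ₁ ≠ 0) (hδ₂0 : δ₂ ≠ 0) (hτ₁0 : τ₁ ≠ 0) (hτ₂0 : τ₂ ≠ 0)
    (hη₁0 : η₁ ≠ 0) (hη₂0 : η₂ ≠ 0) :
    IsSidonSpace F
        (Submodule.span F
          {x : K | ∃ a ∈ Fk, ∃ u ∈ Fk, ∃ e ∈ Fk,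
            x = δ₁ * a + δ₂ * a ^ q * γ + τ₁ * u * ξ + τ₂ * u ^ q * ξ ^ 2 + η₁ * e * ζ + η₂ * e ^ q * ζ ^ 2}) ∧
      Module.finrank F
        ↥(Submodule.span F
          {x : K | ∃ a ∈ Fk, ∃ u ∈ Fk, ∃ e ∈ Fk,
            x = δ₁ * a + δ₂ * a ^ q * γ + τ₁ * u * ξ + τ₂ * u ^ q * ξ ^ 2 + η₁ * e * ζ + η₂ * e ^ q * ζ ^ 2}) = 3 * k := by
  have hq0 : q ≠ 0 := hq.pos.ne'
  have : Finite K := Nat.finite_of_card_ne_zero (by rw [hK]; exact pow_ne_zero _ hq0)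
  have := Fintype.ofFinite F
  have hFq : Fintype.card F = q := by rw [← Nat.card_eq_fintype_card, hF]
  have pow_add (x y : K) : (x + y) ^ q = x ^ q + y ^ q := by
    simpa [hFq] using map_add (FiniteField.frobeniusAlgHom F K) x y
  have hinj : Function.Injective fun x : K ↦ x ^ q := by
    have h := (FiniteField.frobeniusAlgHom F K).toRingHom.injective
    simpa [Function.Injective, hFq] using h
  have pow_mem_F {c : K} (hc : c ∈ F) : c ^ q = c := by
    have h := FiniteField.pow_card (⟨c, hc⟩ : F)
    rw [hFq] at h
    exact congrArg Subtype.val h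
  have mem_F {c : K} (hc : c ^ q = c) : c ∈ F :=
    F.mem_of_pow_natCard_eq_self (by rwa [hF])
  rw [← hdegγ] at hdegγ'
  rw [← hdegξ] at hdegξ'
  rw [← hdegζ] at hdegζ'
  let Φ : K → K → K → K := fun a u e ↦
    δ₁ * a + δ₂ * a ^ q * γ + τ₁ * u * ξ + τ₂ * u ^ q * ξ ^ 2 + η₁ * e * ζ + η₂ * e ^ q * ζ ^ 2
  have Φ_add (a u e a' u' e' : K) :
      Φ a u e + Φ a' u' e' = Φ (a + a') (u + u') (e + e') := by
    simp only [Φ, pow_add]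
    ring
  have Φ_mul {c : K} (hc : c ^ q = c) (a u e : K) : c * Φ a u e = Φ (c * a) (c * u) (c * e) := by
    simp only [Φ, mul_pow, hc]
    ring
  let W : Submodule F K :=
    { carrier := {x : K | ∃ a ∈ Fk, ∃ u ∈ Fk, ∃ e ∈ Fk, x = Φ a u e}
      add_mem' := by
        rintro _ _ ⟨a, ha, u, hu, e, he, rfl⟩ ⟨a', ha', u', hu', e', he', rfl⟩
        exact ⟨_, add_mem ha ha', _, add_mem hu hu', _, add_mem he he', Φ_add ..⟩
      zero_mem' := ⟨0, zero_mem _, 0, zero_mem _, 0, zero_mem _, by simp [Φ, hq0]⟩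
      smul_mem' := by
        rintro ⟨c, hc⟩ _ ⟨a, ha, u, hu, e, he, rfl⟩
        have hck := hFFk hc
        exact ⟨_, mul_mem hck ha, _, mul_mem hck hu, _, mul_mem hck he,
          Φ_mul (pow_mem_F hc) ..⟩ }
  have hW : Submodule.span F {x : K | ∃ a ∈ Fk, ∃ u ∈ Fk, ∃ e ∈ Fk,
      x = δ₁ * a + δ₂ * a ^ q * γ + τ₁ * u * ξ + τ₂ * u ^ q * ξ ^ 2 + η₁ * e * ζ +
        η₂ * e ^ q * ζ ^ 2} = W := Submodule.span_eq W
  rw [hW]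
  have hkr := hFkFm.trans hFmFr
  have mem_Fm {a : K} (ha : a ∈ Fk) : δ₁ * a + δ₂ * a ^ q * γ ∈ Fm :=
    add_mem (mul_mem (hFkFm hδ₁) (hFkFm ha))
      (mul_mem (mul_mem (hFkFm hδ₂) (pow_mem (hFkFm ha) q)) hγFm)
  have mem_Fr {a u : K} (ha : a ∈ Fk) (hu : u ∈ Fk) :
      δ₁ * a + δ₂ * a ^ q * γ + τ₁ * u * ξ + τ₂ * u ^ q * ξ ^ 2 ∈ Fr :=
    add_mem (add_mem (hFmFr (mem_Fm ha)) (mul_mem (mul_mem (hkr hτ₁) (hkr hu)) hξFr))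
      (mul_mem (mul_mem (hkr hτ₂) (pow_mem (hkr hu) q)) (pow_mem hξFr 2))
  refine ⟨?_, ?_⟩
  · intro x₀ hx₀ x₁ hx₁ x₂ hx₂ x₃ hx₃ hx₀0 _ hx₂0 hx₃0 hprod
    have hx : ∀ i, ![x₀, x₁, x₂, x₃] i ∈ W := by
      intro i
      fin_cases i <;> assumption
    choose a ha u hu e he hΦ using hx
    have hxΦ : x₀ = Φ (a 0) (u 0) (e 0) ∧ x₁ = Φ (a 1) (u 1) (e 1) ∧
        x₂ = Φ (a 2) (u 2) (e 2) ∧ x₃ = Φ (a 3) (u 3) (e 3) := ⟨hΦ 0, hΦ 1, hΦ 2, hΦ 3⟩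
    obtain ⟨h0, h1, h2, h3⟩ := hxΦ
    have hP : ProdEq (fun i ↦ Φ (a i) (u i) (e i)) := by
      simpa only [ProdEq, ← h0, ← h1, ← h2, ← h3] using hprod
    obtain ⟨hP, hee, hAe, hAe', hee'⟩ := ProdEq.frobenius_coeffs Fr hdegζ' hinj
      (fun i ↦ mem_Fr (ha i) (hu i)) (fun i ↦ hkr (he i)) (hkr hη₁) (hkr hη₂) hη₁0 hη₂0 hP
    obtain ⟨hP, huu, hAu, hAu', huu'⟩ := ProdEq.frobenius_coeffs Fm hdegξ' hinj
      (fun i ↦ mem_Fm (ha i)) (fun i ↦ hFkFm (hu i)) (hFkFm hτ₁) (hFkFm hτ₂) hτ₁0 hτ₂0 hP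
    have mem₁ (i) : δ₁ * a i ∈ Fk := mul_mem hδ₁ (ha i)
    have mem₂ (i) : δ₂ * a i ^ q ∈ Fk := mul_mem hδ₂ (pow_mem (ha i) q)
    obtain ⟨haa, haa', -⟩ := ProdEq.linear_coeffs Fk hdegγ' mem₁ mem₂ hP
    replace haa := haa.of_mul hδ₁0
    replace haa' := haa'.of_mul_mul hδ₁0 hδ₂0
    have split_ξ {w : Fin 4 → K} (hw : ∀ i, w i ∈ Fk) (h : SymmEq (fun i ↦ δ₁ * a i +
        δ₂ * a i ^ q * γ + τ₁ * u i * ξ + τ₂ * u i ^ q * ξ ^ 2) w) :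
        SymmEq (fun i ↦ δ₁ * a i + δ₂ * a i ^ q * γ) w ∧ SymmEq u w ∧
          SymmEq (fun i ↦ u i ^ q) w := by
      obtain ⟨h0, h1, h2⟩ := SymmEq.quadratic_coeffs Fm (by omega) (fun i ↦ mem_Fm (ha i))
        (fun i ↦ mul_mem (hFkFm hτ₁) (hFkFm (hu i)))
        (fun i ↦ mul_mem (hFkFm hτ₂) (pow_mem (hFkFm (hu i)) q)) (fun i ↦ hFkFm (hw i)) h
      exact ⟨h0, h1.of_mul_left hτ₁0, h2.of_mul_left hτ₂0⟩
    have split_γ {w : Fin 4 → K} (hw : ∀ i, w i ∈ Fk)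
        (h : SymmEq (fun i ↦ δ₁ * a i + δ₂ * a i ^ q * γ) w) :
        SymmEq a w ∧ SymmEq (fun i ↦ a i ^ q) w := by
      obtain ⟨h0, h1, -⟩ := SymmEq.quadratic_coeffs Fk hdegγ' mem₁ mem₂ (C := 0)
        (fun _ ↦ zero_mem _) hw (by simpa using h)
      exact ⟨h0.of_mul_left hδ₁0, h1.of_mul_left hδ₂0⟩
    have hu' (i) : u i ^ q ∈ Fk := pow_mem (hu i) q
    have he' (i) : e i ^ q ∈ Fk := pow_mem (he i) q
    obtain ⟨hAe, hue, hu'e⟩ := split_ξ he hAe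
    obtain ⟨hAe', hue', -⟩ := split_ξ he' hAe'
    obtain ⟨hae, ha'e⟩ := split_γ he hAe
    obtain ⟨hae', -⟩ := split_γ he' hAe'
    obtain ⟨hau, ha'u⟩ := split_γ hu hAu
    obtain ⟨hau', -⟩ := split_γ hu' hAu'
    have hv0 {i : Fin 4} (hi : Φ (a i) (u i) (e i) ≠ 0) : ![a i, u i, e i] ≠ 0 := by
      intro h
      apply hi
      have ha0 : a i = 0 := congrFun h 0
      have hu0 : u i = 0 := congrFun h 1
      have he0 : e i = 0 := congrFun h 2
      simp [Φ, ha0, hu0, he0, hq0]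
    obtain ⟨c, hc0, hcq, hor⟩ := proportional_of_frobenius_mul_eq (q := q)
      (v := fun i ↦ ![a i, u i, e i]) (hv0 (h0 ▸ hx₀0)) (hv0 (h2 ▸ hx₂0)) (hv0 (h3 ▸ hx₃0))
      (by
        intro i
        fin_cases i
        exacts [haa, huu, hee])
      (by
        intro i j
        fin_cases i <;> fin_cases j
        exacts [haa.symmEq, hau, hae, hau.symm, huu.symmEq, hue, hae.symm, hue.symm, hee.symmEq])
      (by
        intro i j
        fin_cases i <;> fin_cases j
        exacts [haa', hau', hae', ha'u.symm, huu', hue', ha'e.symm, hu'e.symm, hee'])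
    have smul_Φ {i j : Fin 4} (h : ![a i, u i, e i] = c • ![a j, u j, e j]) :
        Φ (a i) (u i) (e i) = c * Φ (a j) (u j) (e j) := by
      have ha : a i = c * a j := congrFun h 0
      have hu : u i = c * u j := congrFun h 1
      have he : e i = c * e j := congrFun h 2
      rw [Φ_mul hcq, ha, hu, he]
    have span_eq {x y : K} (h : x = c * y) :
        Submodule.span F {x} = Submodule.span F {y} := by
      have hunit : IsUnit (⟨c, mem_F hcq⟩ : F) :=
        isUnit_iff_ne_zero.2 fun h ↦ hc0 (congrArg Subtype.val h)
      rw [h]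
      exact Submodule.span_singleton_smul_eq hunit y
    rcases hor with ⟨h, h'⟩ | ⟨h, h'⟩
    · have h20 := span_eq (smul_Φ h)
      have h13 := span_eq (smul_Φ h')
      rw [h0, h1, h2, h3, h20, h13]
    · have h30 := span_eq (smul_Φ h)
      have h12 := span_eq (smul_Φ h')
      rw [h0, h1, h2, h3, h30, h12, Set.pair_comm]
  · let f : Fk × Fk × Fk → W := fun p ↦
      ⟨Φ p.1 p.2.1 p.2.2, p.1, p.1.2, p.2.1, p.2.1.2, p.2.2, p.2.2.2, rfl⟩
    have hf : Function.Bijective f := by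
      refine ⟨?_, ?_⟩
      · rintro ⟨⟨a, ha⟩, ⟨u, hu⟩, ⟨e, he⟩⟩ ⟨⟨a', ha'⟩, ⟨u', hu'⟩, ⟨e', he'⟩⟩ h
        have h : Φ a u e = Φ a' u' e' := congrArg Subtype.val h
        obtain ⟨h0, h1, -⟩ := quadratic_coeffs_eq_zero Fr (lt_trans (by norm_num) hdegζ')
          (sub_mem (mem_Fr ha hu) (mem_Fr ha' hu'))
          (sub_mem (mul_mem (hkr hη₁) (hkr he)) (mul_mem (hkr hη₁) (hkr he')))
          (sub_mem (mul_mem (hkr hη₂) (pow_mem (hkr he) q))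
            (mul_mem (hkr hη₂) (pow_mem (hkr he') q)))
          (by linear_combination h)
        obtain ⟨h2, h3, -⟩ := quadratic_coeffs_eq_zero Fm (lt_trans (by norm_num) hdegξ')
          (sub_mem (mem_Fm ha) (mem_Fm ha'))
          (sub_mem (mul_mem (hFkFm hτ₁) (hFkFm hu)) (mul_mem (hFkFm hτ₁) (hFkFm hu')))
          (sub_mem (mul_mem (hFkFm hτ₂) (pow_mem (hFkFm hu) q))
            (mul_mem (hFkFm hτ₂) (pow_mem (hFkFm hu') q)))
          (by linear_combination h0)
        obtain ⟨h4, -, -⟩ := quadratic_coeffs_eq_zero Fk hdegγ'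
          (sub_mem (mul_mem hδ₁ ha) (mul_mem hδ₁ ha'))
          (sub_mem (mul_mem hδ₂ (pow_mem ha q)) (mul_mem hδ₂ (pow_mem ha' q)))
          (zero_mem _) (by linear_combination h2)
        obtain rfl := mul_left_cancel₀ hη₁0 (sub_eq_zero.1 h1)
        obtain rfl := mul_left_cancel₀ hτ₁0 (sub_eq_zero.1 h3)
        obtain rfl := mul_left_cancel₀ hδ₁0 (sub_eq_zero.1 h4)
        rfl
      · rintro ⟨_, a, ha, u, hu, e, he, rfl⟩
        exact ⟨(⟨a, ha⟩, ⟨u, hu⟩, ⟨e, he⟩), rfl⟩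
    have hcard := Nat.card_congr (Equiv.ofBijective f hf)
    rw [Nat.card_prod, Nat.card_prod, hFk, Module.natCard_eq_pow_finrank (K := F), hF] at hcard
    apply Nat.pow_right_injective hq.two_le
    simp only [← hcard]
    ring
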